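/- For every n ≥ 2, the rank-width of the path graph on n vertices (vertex set Fin n, with i and j adjacent iff they differ by exactly 1) equals 1. (Consequently, the Schmidt-rank width of the 1D cluster states is bounded, which underlies the non-universality of the 1D cluster states.) -/

import Mathlib

open scoped BigOperators Classical

noncomputable section

/-- The cut-rank `cutrk_G(A)`: the rank over `GF(2)` of the `A × Aᶜ` adjacency
submatrix of `G`. -/
def cutRank {V : Type} [Fintype V] (G : SimpleGraph V) (A : Set V) : ℕ :=
  Matrix.rank (Matrix.of fun (a : ↥A) (b : ↥Aᶜ) =>
    if G.Adj a.val b.val then (1 : ZMod 2) else 0)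

/-- The degree of a vertex: the number of its neighbors. -/
def deg {M : ℕ} (T : SimpleGraph (Fin M)) (v : Fin M) : ℕ :=
  (T.neighborSet v).ncard

/-- A subcubic tree: a finite tree in which every vertex has degree 1 or 3. -/
def IsSubcubicTree {M : ℕ} (T : SimpleGraph (Fin M)) : Prop :=
  T.IsTree ∧ ∀ v, deg T v = 1 ∨ deg T v = 3

/-- The set of vertices lying in the connected component of the endpoint `w` of
the deleted edge `e` of the tree `T`, transported to `V` along the leaf
labeling `ℓ`. -/
def leafSide {M : ℕ} (T : SimpleGraph (Fin M)) {V : Type}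
    (ℓ : {v : Fin M // deg T v = 1} ≃ V) (e : Sym2 (Fin M)) (w : Fin M) : Set V :=
  {i : V | ∃ l : {v : Fin M // deg T v = 1},
      (T.deleteEdges {e}).Reachable w l.val ∧ ℓ l = i}

/-- The rank-width of `G`: the minimum over all subcubic trees `T` whose leaves
are identified with the vertices of `G` of the maximum over the edges `e` of `T`
of the cut-rank of the induced bipartition. -/
def rankWidth {V : Type} [Fintype V] [DecidableEq V] (G : SimpleGraph V) : ℕ :=
  sInf { r : ℕ | ∃ (M : ℕ) (T : SimpleGraph (Fin M)), IsSubcubicTree T ∧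
    ∃ ℓ : {v : Fin M // deg T v = 1} ≃ V,
      r = sSup { s : ℕ | ∃ e ∈ T.edgeSet, ∃ w, w ∈ e ∧
        s = cutRank G (leafSide T ℓ e w) } }


/-- The path graph on `n` vertices: vertex set `Fin n`, with `i` and `j` adjacent
iff they differ by exactly `1`. -/
def pathGraph' (n : ℕ) : SimpleGraph (Fin n) :=
  SimpleGraph.fromRel fun a b => a.val + 1 = b.val

theorem pathGraph'_adj {n : ℕ} (a b : Fin n) :
    (pathGraph' n).Adj a b ↔ a.val + 1 = b.val ∨ b.val + 1 = a.val := by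
  simp only [pathGraph', SimpleGraph.fromRel_adj, ne_eq, Fin.ext_iff]
  omega

/-- The edges of `G` across `A` form a complete bipartite graph between a subset of `A` and a
subset of its complement. -/
def IsBicliqueCut {V : Type} (G : SimpleGraph V) (A : Set V) : Prop :=
  ∃ f g : V → Prop, ∀ a ∈ A, ∀ b ∉ A, (G.Adj a b ↔ f a ∧ g b)

theorem IsBicliqueCut.compl {V : Type} {G : SimpleGraph V} {A : Set V}
    (h : IsBicliqueCut G A) : IsBicliqueCut G Aᶜ := by
  obtain ⟨f, g, h⟩ := h
  refine ⟨g, f, fun a ha b hb => ?_⟩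
  rw [G.adj_comm, h b (not_not.mp hb) a ha, and_comm]

theorem isBicliqueCut_singleton {V : Type} (G : SimpleGraph V) (v : V) :
    IsBicliqueCut G {v} :=
  ⟨fun _ => True, G.Adj v, fun a ha b _ => by rw [Set.mem_singleton_iff.mp ha]; simp⟩

theorem isBicliqueCut_pathGraph'_le {n : ℕ} (m : ℕ) :
    IsBicliqueCut (pathGraph' n) {i | m ≤ i.val} := by
  refine ⟨fun a => a.val = m, fun b => b.val + 1 = m, fun a ha b hb => ?_⟩
  simp only [Set.mem_ofPred_eq] at ha hb
  rw [pathGraph'_adj]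
  omega

theorem IsBicliqueCut.cutRank_le_one {V : Type} [Fintype V] {G : SimpleGraph V} {A : Set V}
    (h : IsBicliqueCut G A) : cutRank G A ≤ 1 := by
  obtain ⟨f, g, h⟩ := h
  have key : (Matrix.of fun (a : ↥A) (b : ↥Aᶜ) =>
      if G.Adj a.val b.val then (1 : ZMod 2) else 0) =
      Matrix.vecMulVec (fun a : ↥A => if f a.val then (1 : ZMod 2) else 0)
        (fun b : ↥Aᶜ => if g b.val then (1 : ZMod 2) else 0) := by
    ext a b
    have := h a.val a.2 b.val b.2
    by_cases hf : f a.val <;> by_cases hg : g b.val <;> simp_all [Matrix.vecMulVec_apply]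
  unfold cutRank
  rw [key]
  exact Matrix.rank_vecMulVec_le _ _

theorem cutRank_pos {V : Type} [Fintype V] {G : SimpleGraph V} {A : Set V} {a b : V}
    (ha : a ∈ A) (hb : b ∉ A) (hab : G.Adj a b) : 0 < cutRank G A := by
  rw [Nat.pos_iff_ne_zero]
  intro h
  unfold cutRank at h
  rw [Matrix.rank, Submodule.finrank_eq_zero, LinearMap.range_eq_bot] at h
  have h1 := congrFun (LinearMap.congr_fun h (Pi.single ⟨b, hb⟩ 1)) ⟨a, ha⟩
  simp [hab] at h1

theorem cutRank_le_card {V : Type} [Fintype V] (G : SimpleGraph V) (A : Set V) :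
    cutRank G A ≤ Fintype.card V :=
  (Matrix.rank_le_card_height _).trans (Fintype.card_subtype_le _)

theorem leafSide_leaf {M : ℕ} {T : SimpleGraph (Fin M)} {V : Type}
    (ℓ : {v : Fin M // deg T v = 1} ≃ V) (l : {v : Fin M // deg T v = 1}) {u : Fin M}
    (hu : T.neighborSet l.val = {u}) : leafSide T ℓ s(l.val, u) l.val = {ℓ l} := by
  ext i
  constructor
  · rintro ⟨⟨m, hm⟩, ⟨p⟩, rfl⟩
    dsimp only at p
    cases p with
    | nil => rfl
    | cons h q =>
      rw [SimpleGraph.deleteEdges_adj] at h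
      have : _ ∈ T.neighborSet l.val := h.1
      rw [hu, Set.mem_singleton_iff] at this
      exact absurd (by rw [this]; rfl) h.2
  · rintro rfl
    exact ⟨l, .rfl, rfl⟩

/-- A graph without isolated vertices has positive width along any leaf-labelled tree. -/
theorem one_le_sSup_cutRank {M : ℕ} (T : SimpleGraph (Fin M)) {V : Type} [Fintype V]
    {G : SimpleGraph V} (ℓ : {v : Fin M // deg T v = 1} ≃ V) {a b : V} (hab : G.Adj a b) :
    1 ≤ sSup { s : ℕ | ∃ e ∈ T.edgeSet, ∃ w, w ∈ e ∧ s = cutRank G (leafSide T ℓ e w) } := by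
  obtain ⟨u, hu⟩ := Set.ncard_eq_one.mp (ℓ.symm a).2
  have hadj : T.Adj (ℓ.symm a).val u := by
    have : u ∈ T.neighborSet (ℓ.symm a).val := by rw [hu]; rfl
    exact this
  have hpos : 0 < cutRank G (leafSide T ℓ s((ℓ.symm a).val, u) (ℓ.symm a).val) := by
    rw [leafSide_leaf ℓ _ hu, ℓ.apply_symm_apply]
    exact cutRank_pos rfl (fun h => hab.ne (Set.mem_singleton_iff.mp h).symm) hab
  refine le_trans hpos (le_csSup ⟨Fintype.card V, ?_⟩ ⟨_, hadj, _, Sym2.mem_mk_left _ _, rfl⟩)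
  rintro s ⟨e, -, w, -, rfl⟩
  exact cutRank_le_card _ _

/-- The parent of a vertex of the caterpillar rooted at `0`: the children of `0` are `{1}`, and
those of an odd vertex `v` are `v + 1` and `v + 2`. -/
def caterpillarParent (v : ℕ) : ℕ := 2 * (v / 2) - 1

/-- The caterpillar on `M` vertices. -/
def caterpillar (M : ℕ) : SimpleGraph (Fin M) :=
  SimpleGraph.fromRel fun a b => b.val ≠ 0 ∧ a.val = caterpillarParent b.val

/-- The descendants of the vertex `k` of the caterpillar. -/
def caterpillarBelow (k v : ℕ) : Prop := v = k ∨ (k % 2 = 1 ∧ k ≤ v)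

theorem caterpillarParent_lt {v : ℕ} (hv : v ≠ 0) : caterpillarParent v < v := by
  unfold caterpillarParent; omega

theorem caterpillar_adj {M : ℕ} (a b : Fin M) : (caterpillar M).Adj a b ↔
    (b.val ≠ 0 ∧ a.val = caterpillarParent b.val) ∨
      (a.val ≠ 0 ∧ b.val = caterpillarParent a.val) := by
  simp only [caterpillar, SimpleGraph.fromRel_adj, ne_eq, Fin.ext_iff, caterpillarParent]
  omega

theorem caterpillarBelow_parent {k v : ℕ} (hk : k ≠ 0) (hv : v ≠ 0) (hvk : v ≠ k) :
    caterpillarBelow k (caterpillarParent v) ↔ caterpillarBelow k v := by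
  unfold caterpillarBelow caterpillarParent; omega

theorem not_caterpillarBelow_parent {k : ℕ} (hk : k ≠ 0) :
    ¬ caterpillarBelow k (caterpillarParent k) := by
  unfold caterpillarBelow caterpillarParent; omega

section

variable {M : ℕ} {k p : Fin M}

theorem caterpillarBelow_congr_of_reachable (hk : k.val ≠ 0)
    (hp : p.val = caterpillarParent k.val) {v w : Fin M}
    (h : ((caterpillar M).deleteEdges {s(p, k)}).Reachable v w) :
    caterpillarBelow k v ↔ caterpillarBelow k w := by
  obtain ⟨q⟩ := h
  induction q with
  | nil => rfl
  | @cons a b c h q ih =>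
    rw [← ih]
    rw [SimpleGraph.deleteEdges_adj, caterpillar_adj] at h
    obtain ⟨⟨hb, hab⟩ | ⟨ha, hab⟩, hne⟩ := h
    · rw [hab]
      refine caterpillarBelow_parent hk hb fun hbk => hne ?_
      rw [Fin.ext (hbk : b.val = k.val), Fin.ext (by rw [hab, hbk, hp] : a.val = p.val)]
      rfl
    · rw [hab]
      refine (caterpillarBelow_parent hk ha fun hak => hne ?_).symm
      rw [Fin.ext (hak : a.val = k.val), Fin.ext (by rw [hab, hak, hp] : b.val = p.val)]
      exact Sym2.eq_swap

theorem deleteEdges_caterpillar_adj_parent {v w : Fin M} (hv : v.val ≠ 0) (hvk : v ≠ k)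
    (hp : p.val = caterpillarParent k.val) (hw : w.val = caterpillarParent v.val) :
    ((caterpillar M).deleteEdges {s(p, k)}).Adj v w := by
  rw [SimpleGraph.deleteEdges_adj, caterpillar_adj]
  refine ⟨Or.inr ⟨hv, hw⟩, fun h => ?_⟩
  rcases Sym2.eq_iff.mp (Set.mem_singleton_iff.mp h) with ⟨rfl, rfl⟩ | ⟨rfl, -⟩
  · have h1 := caterpillarParent_lt hv
    unfold caterpillarParent at *
    omega
  · exact hvk rfl

theorem reachable_of_caterpillarBelow (hk : k.val ≠ 0) (hp : p.val = caterpillarParent k.val)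
    (v : Fin M) (hv : caterpillarBelow k v) :
    ((caterpillar M).deleteEdges {s(p, k)}).Reachable v k := by
  induction v using WellFoundedLT.induction with
  | _ v ih =>
    by_cases hvk : v = k
    · rw [hvk]
    have hv0 : v.val ≠ 0 := by unfold caterpillarBelow at hv; omega
    have hlt := caterpillarParent_lt hv0
    refine (deleteEdges_caterpillar_adj_parent (w := ⟨_, hlt.trans v.2⟩) hv0 hvk hp
      rfl).reachable.trans (ih _ hlt ?_)
    exact (caterpillarBelow_parent hk hv0 fun h => hvk (Fin.ext h)).mpr hv

theorem reachable_zero_of_not_caterpillarBelow (hk : k.val ≠ 0)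
    (hp : p.val = caterpillarParent k.val) (v : Fin M) (hv : ¬ caterpillarBelow k v) :
    ((caterpillar M).deleteEdges {s(p, k)}).Reachable v ⟨0, v.pos⟩ := by
  induction v using WellFoundedLT.induction with
  | _ v ih =>
    by_cases hv0 : v.val = 0
    · rw [Fin.ext (by simpa using hv0 : v.val = (⟨0, v.pos⟩ : Fin M).val)]
    have hvk : v.val ≠ k.val := fun h => hv (Or.inl h)
    have hlt := caterpillarParent_lt hv0
    refine (deleteEdges_caterpillar_adj_parent (w := ⟨_, hlt.trans v.2⟩) hv0
      (fun h => hvk (congrArg _ h)) hp rfl).reachable.trans (ih _ hlt ?_)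
    exact fun h => hv ((caterpillarBelow_parent hk hv0 hvk).mp h)

/-- Deleting the edge above `k` splits the caterpillar into the descendants of `k` and the rest. -/
theorem deleteEdges_caterpillar_reachable_iff (hk : k.val ≠ 0)
    (hp : p.val = caterpillarParent k.val) (v w : Fin M) :
    ((caterpillar M).deleteEdges {s(p, k)}).Reachable v w ↔
      (caterpillarBelow k v ↔ caterpillarBelow k w) := by
  refine ⟨caterpillarBelow_congr_of_reachable hk hp, fun h => ?_⟩
  by_cases hv : caterpillarBelow k v
  · exact (reachable_of_caterpillarBelow hk hp v hv).trans
      (reachable_of_caterpillarBelow hk hp w (h.mp hv)).symm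
  · exact (reachable_zero_of_not_caterpillarBelow hk hp v hv).trans
      (reachable_zero_of_not_caterpillarBelow hk hp w (mt h.mpr hv)).symm

end

theorem caterpillar_reachable_zero {M : ℕ} (v : Fin M) :
    (caterpillar M).Reachable v ⟨0, v.pos⟩ := by
  induction v using WellFoundedLT.induction with
  | _ v ih =>
    by_cases hv0 : v.val = 0
    · rw [Fin.ext (by simpa using hv0 : v.val = (⟨0, v.pos⟩ : Fin M).val)]
    have hlt := caterpillarParent_lt hv0
    have hadj : (caterpillar M).Adj v ⟨_, hlt.trans v.2⟩ :=
      (caterpillar_adj _ _).mpr (Or.inr ⟨hv0, rfl⟩)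
    exact hadj.reachable.trans (ih _ hlt)

theorem caterpillar_exists_eq_of_mem_edgeSet {M : ℕ} {e : Sym2 (Fin M)}
    (he : e ∈ (caterpillar M).edgeSet) :
    ∃ p k : Fin M, k.val ≠ 0 ∧ p.val = caterpillarParent k.val ∧ e = s(p, k) := by
  induction e with
  | _ a b =>
    rcases (caterpillar_adj a b).mp he with ⟨h0, h⟩ | ⟨h0, h⟩
    · exact ⟨a, b, h0, h, rfl⟩
    · exact ⟨b, a, h0, h, Sym2.eq_swap⟩

theorem caterpillar_isTree {M : ℕ} (hM : 0 < M) : (caterpillar M).IsTree := by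
  have : Nonempty (Fin M) := ⟨⟨0, hM⟩⟩
  refine ⟨⟨fun v w => (caterpillar_reachable_zero v).trans (caterpillar_reachable_zero w).symm⟩, ?_⟩
  rw [SimpleGraph.isAcyclic_iff_forall_isBridge]
  intro e he
  obtain ⟨p, k, hk, hp, rfl⟩ := caterpillar_exists_eq_of_mem_edgeSet he
  rw [SimpleGraph.isBridge_iff, deleteEdges_caterpillar_reachable_iff hk hp, hp]
  exact fun h => not_caterpillarBelow_parent hk (h.mpr (Or.inl rfl))

theorem deg_caterpillar_of_leaf {n : ℕ} (hn : 2 ≤ n) (v : Fin (2 * n - 2))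
    (hv : v.val % 2 = 0 ∨ v.val = 2 * n - 3) : deg (caterpillar (2 * n - 2)) v = 1 := by
  refine Set.ncard_eq_one.mpr
    ⟨⟨if v.val = 0 then 1 else caterpillarParent v.val, ?_⟩, Set.ext fun w => ?_⟩
  · unfold caterpillarParent; split_ifs <;> omega
  · simp only [SimpleGraph.mem_neighborSet, caterpillar_adj, Set.mem_singleton_iff, Fin.ext_iff,
      caterpillarParent]
    split_ifs <;> omega

theorem deg_caterpillar_of_not_leaf {n : ℕ} (v : Fin (2 * n - 2))
    (hv : ¬ (v.val % 2 = 0 ∨ v.val = 2 * n - 3)) : deg (caterpillar (2 * n - 2)) v = 3 := by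
  have h0 := v.2
  refine Set.ncard_eq_three.mpr ⟨⟨caterpillarParent v.val, ?_⟩, ⟨v.val + 1, by omega⟩,
    ⟨v.val + 2, by omega⟩, ?_, ?_, ?_, Set.ext fun w => ?_⟩
  · unfold caterpillarParent; omega
  · simp only [ne_eq, Fin.ext_iff, caterpillarParent]; omega
  · simp only [ne_eq, Fin.ext_iff, caterpillarParent]; omega
  · simp only [ne_eq, Fin.ext_iff]; omega
  · simp only [SimpleGraph.mem_neighborSet, caterpillar_adj, Set.mem_insert_iff,
      Set.mem_singleton_iff, Fin.ext_iff, caterpillarParent]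
    omega

theorem deg_caterpillar_eq_one_iff {n : ℕ} (hn : 2 ≤ n) (v : Fin (2 * n - 2)) :
    deg (caterpillar (2 * n - 2)) v = 1 ↔ v.val % 2 = 0 ∨ v.val = 2 * n - 3 := by
  refine ⟨fun h => ?_, deg_caterpillar_of_leaf hn v⟩
  by_contra hv
  rw [deg_caterpillar_of_not_leaf v hv] at h
  omega

theorem caterpillar_isSubcubicTree {n : ℕ} (hn : 2 ≤ n) :
    IsSubcubicTree (caterpillar (2 * n - 2)) := by
  refine ⟨caterpillar_isTree (by omega), fun v => ?_⟩
  by_cases hv : v.val % 2 = 0 ∨ v.val = 2 * n - 3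
  · exact Or.inl (deg_caterpillar_of_leaf hn v hv)
  · exact Or.inr (deg_caterpillar_of_not_leaf v hv)

/-- The leaves of the caterpillar, listed from the root downwards. -/
def caterpillarLeaves {n : ℕ} (hn : 2 ≤ n) :
    {v : Fin (2 * n - 2) // deg (caterpillar (2 * n - 2)) v = 1} ≃ Fin n where
  toFun v := ⟨(v.val.val + 1) / 2, by have := v.val.2; omega⟩
  invFun i := ⟨⟨if i.val = n - 1 then 2 * n - 3 else 2 * i.val, by split_ifs <;> omega⟩, by
    rw [deg_caterpillar_eq_one_iff hn]
    dsimp only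
    split_ifs <;> omega⟩
  left_inv v := by
    have h := (deg_caterpillar_eq_one_iff hn v.val).mp v.2
    have := v.val.2
    refine Subtype.ext (Fin.ext ?_)
    dsimp only
    split_ifs <;> omega
  right_inv i := by
    refine Fin.ext ?_
    dsimp only
    split_ifs <;> omega

theorem isBicliqueCut_caterpillarBelow {n : ℕ} (hn : 2 ≤ n) {k : Fin (2 * n - 2)} :
    IsBicliqueCut (pathGraph' n)
      {i | caterpillarBelow k ((caterpillarLeaves hn).symm i).val.val} := by
  have hk2 := k.2
  by_cases hk : k.val % 2 = 1
  · convert isBicliqueCut_pathGraph'_le (n := n) ((k.val + 1) / 2) using 1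
    ext i
    simp only [caterpillarBelow, caterpillarLeaves, Equiv.coe_fn_symm_mk, Set.mem_ofPred_eq]
    split_ifs <;> omega
  · convert isBicliqueCut_singleton (pathGraph' n) ⟨k.val / 2, by omega⟩ using 1
    ext i
    simp only [caterpillarBelow, caterpillarLeaves, Equiv.coe_fn_symm_mk, Set.mem_ofPred_eq,
      Set.mem_singleton_iff, Fin.ext_iff]
    split_ifs <;> omega

theorem cutRank_leafSide_caterpillar_le_one {n : ℕ} (hn : 2 ≤ n) {e : Sym2 (Fin (2 * n - 2))}
    (he : e ∈ (caterpillar (2 * n - 2)).edgeSet) (w : Fin (2 * n - 2)) :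
    cutRank (pathGraph' n) (leafSide (caterpillar (2 * n - 2)) (caterpillarLeaves hn) e w) ≤ 1 := by
  obtain ⟨p, k, hk, hp, rfl⟩ := caterpillar_exists_eq_of_mem_edgeSet he
  apply IsBicliqueCut.cutRank_le_one
  have hmem : ∀ i, i ∈ leafSide (caterpillar (2 * n - 2)) (caterpillarLeaves hn) s(p, k) w ↔
      (caterpillarBelow k w ↔ caterpillarBelow k ((caterpillarLeaves hn).symm i).val.val) := by
    intro i
    rw [← deleteEdges_caterpillar_reachable_iff hk hp]
    constructor
    · rintro ⟨l, hl, rfl⟩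
      rwa [Equiv.symm_apply_apply]
    · exact fun h => ⟨_, h, Equiv.apply_symm_apply _ _⟩
  by_cases hw : caterpillarBelow k w
  · convert isBicliqueCut_caterpillarBelow hn (k := k) using 1
    ext i
    simp [hmem, hw]
  · convert (isBicliqueCut_caterpillarBelow hn (k := k)).compl using 1
    ext i
    simp [hmem, hw]

/-- For every `n ≥ 2`, the rank-width of the path graph on `n` vertices equals
`1`.  (Consequently, the Schmidt-rank width of the 1D cluster states is bounded,
which underlies the non-universality of the 1D cluster states.) -/
theorem rankWidth_pathGraph (n : ℕ) (hn : 2 ≤ n) :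
    rankWidth (pathGraph' n) = 1 := by
  have hadj : (pathGraph' n).Adj ⟨0, by omega⟩ ⟨1, by omega⟩ := by
    rw [pathGraph'_adj]; exact Or.inl rfl
  unfold rankWidth
  apply le_antisymm
  · refine le_trans (Nat.sInf_le
      ⟨_, _, caterpillar_isSubcubicTree hn, caterpillarLeaves hn, rfl⟩) (csSup_le' ?_)
    rintro s ⟨e, he, w, -, rfl⟩
    exact cutRank_leafSide_caterpillar_le_one hn he w
  · apply le_csInf
    · exact ⟨_, _, _, caterpillar_isSubcubicTree hn, caterpillarLeaves hn, rfl⟩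
    rintro r ⟨M, T, -, ℓ, rfl⟩
    exact one_le_sSup_cutRank T ℓ hadj
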